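/- arXiv:2603.21817 — 3 statements merged into one kernel-verified Lean document; each statement's English description precedes it below -/
import Mathlib

section
/- (Propagation of bounds.) Under conditions (R2) and (R3), for every t ≥ 0 the time-t kernel satisfies sup_{x∈S} Σ_{y∈S} γ_t(x,y)/ρ(d(x,y)) ≤ ρ(0)^{-1} · exp(C_γ · C_ρ · t). -/
open scoped ENNReal NNReal

/-- The iterated kernels: `γ⁽⁰⁾(x,y) = 1` if `x = y` and `0` otherwise, and
`γ⁽ⁿ⁾(x,y) = ∑_z γ(x,z)·γ⁽ⁿ⁻¹⁾(z,y)`. -/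
noncomputable def iterKernel {S : Type*} [DecidableEq S] (γ : S → S → ℝ≥0) :
    ℕ → S → S → ℝ≥0∞
  | 0 => fun x y => if x = y then 1 else 0
  | n + 1 => fun x y => ∑' z : S, (γ x z : ℝ≥0∞) * iterKernel γ n z y

/-- The time-`t` kernel `γ_t(x,y) = ∑_{n≥0} (tⁿ/n!)·γ⁽ⁿ⁾(x,y)`. -/
noncomputable def timeKernel {S : Type*} [DecidableEq S] (γ : S → S → ℝ≥0)
    (t : ℝ) (x y : S) : ℝ≥0∞ :=
  ∑' n : ℕ, ENNReal.ofReal (t ^ n / n.factorial) * iterKernel γ n x y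

/-- If the weight `w` is submultiplicative up to the constant `C` and `γ` has weighted row sums at
most `K`, then the weighted row sums of the `n`-th iterated kernel grow at most like `(K * C) ^ n`. -/
theorem tsum_iterKernel_mul_le {S : Type*} [DecidableEq S] (γ : S → S → ℝ≥0)
    (w : S → S → ℝ≥0∞) {B C K : ℝ≥0∞} (hdiag : ∀ x, w x x ≤ B)
    (hw : ∀ x y z, w x y ≤ C * (w x z * w z y))
    (hγ : ∀ x, ∑' y, (γ x y : ℝ≥0∞) * w x y ≤ K) (n : ℕ) (x : S) :
    ∑' y, iterKernel γ n x y * w x y ≤ B * (K * C) ^ n := by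
  induction n generalizing x with
  | zero => simpa [iterKernel, ite_mul, tsum_ite_eq'] using hdiag x
  | succ n ih =>
    calc ∑' y, iterKernel γ (n + 1) x y * w x y
        = ∑' y, ∑' z, γ x z * iterKernel γ n z y * w x y := by
          simp only [iterKernel, ENNReal.tsum_mul_right]
      _ ≤ ∑' y, ∑' z, C * (γ x z * w x z) * (iterKernel γ n z y * w z y) := by
          refine ENNReal.tsum_le_tsum fun y => ENNReal.tsum_le_tsum fun z => ?_
          calc γ x z * iterKernel γ n z y * w x y
              ≤ γ x z * iterKernel γ n z y * (C * (w x z * w z y)) := by gcongr; exact hw x y z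
            _ = C * (γ x z * w x z) * (iterKernel γ n z y * w z y) := by ring
      _ = ∑' z, C * (γ x z * w x z) * ∑' y, iterKernel γ n z y * w z y := by
          rw [ENNReal.tsum_comm]
          simp only [ENNReal.tsum_mul_left]
      _ ≤ ∑' z, C * (γ x z * w x z) * (B * (K * C) ^ n) := by
          gcongr with z
          exact ih z
      _ = C * (∑' z, γ x z * w x z) * (B * (K * C) ^ n) := by
          rw [ENNReal.tsum_mul_right, ENNReal.tsum_mul_left]
      _ ≤ C * K * (B * (K * C) ^ n) := by
          gcongr
          exact hγ x
      _ = B * (K * C) ^ (n + 1) := by ring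

theorem ENNReal.tsum_ofReal_pow_div_factorial {a : ℝ} (ha : 0 ≤ a) :
    ∑' n : ℕ, ENNReal.ofReal (a ^ n / n.factorial) = ENNReal.ofReal (Real.exp a) := by
  rw [← ENNReal.ofReal_tsum_of_nonneg (fun n => by positivity) (Real.summable_pow_div_factorial a),
    Real.exp_eq_exp_ℝ, NormedSpace.exp_eq_tsum_div]

/-- Propagation of bounds: under (R2) and (R3), for every `t ≥ 0`,
`sup_x ∑_y γ_t(x,y)/ρ(d(x,y)) ≤ ρ(0)⁻¹ · exp(C_γ·C_ρ·t)`. -/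
theorem timeKernel_bound {S : Type*} [Countable S] [DecidableEq S] [MetricSpace S]
    (ρ : ℝ → ℝ) (hρpos : ∀ r : ℝ, 0 ≤ r → 0 < ρ r)
    (hρmono : ∀ r s : ℝ, 0 ≤ r → r ≤ s → ρ s ≤ ρ r)
    (γ : S → S → ℝ≥0) (hγdiag : ∀ x : S, γ x x = 0)
    (Cρ Cγ : ℝ) (hCρ : 0 < Cρ) (hCγ : 0 < Cγ)
    (hR2 : ∀ x y z : S, ρ (dist x z) * ρ (dist z y) ≤ Cρ * ρ (dist x y))
    (hR3 : ⨆ x : S, ∑' y : S, (γ x y : ℝ≥0∞) / ENNReal.ofReal (ρ (dist x y))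
            ≤ ENNReal.ofReal Cγ)
    (t : ℝ) (ht : 0 ≤ t) :
    ⨆ x : S, ∑' y : S, timeKernel γ t x y / ENNReal.ofReal (ρ (dist x y))
      ≤ ENNReal.ofReal ((ρ 0)⁻¹ * Real.exp (Cγ * Cρ * t)) := by
  have hpos (x y : S) : 0 < ρ (dist x y) := hρpos _ dist_nonneg
  simp only [div_eq_mul_inv, ← ENNReal.ofReal_inv_of_pos (hpos _ _)] at hR3 ⊢
  have hrow := tsum_iterKernel_mul_le γ (fun x y => ENNReal.ofReal (ρ (dist x y))⁻¹)
    (B := ENNReal.ofReal (ρ 0)⁻¹) (C := ENNReal.ofReal Cρ) (K := ENNReal.ofReal Cγ)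
    (fun x => by simp)
    (fun x y z => by
      have hxz := hpos x z
      have hzy := hpos z y
      have hxy := hpos x y
      rw [← ENNReal.ofReal_mul (by positivity), ← ENNReal.ofReal_mul hCρ.le]
      apply ENNReal.ofReal_le_ofReal
      rw [← mul_inv, ← div_eq_mul_inv, inv_eq_one_div, div_le_div_iff₀ hxy (by positivity), one_mul]
      exact hR2 x y z)
    (iSup_le_iff.mp hR3)
  refine iSup_le fun x => ?_
  calc ∑' y, timeKernel γ t x y * ENNReal.ofReal (ρ (dist x y))⁻¹
      = ∑' n : ℕ, ENNReal.ofReal (t ^ n / n.factorial) *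
          ∑' y, iterKernel γ n x y * ENNReal.ofReal (ρ (dist x y))⁻¹ := by
        simp only [timeKernel, ← ENNReal.tsum_mul_right, ← ENNReal.tsum_mul_left, mul_assoc]
        exact ENNReal.tsum_comm
    _ ≤ ∑' n : ℕ, ENNReal.ofReal (t ^ n / n.factorial) *
          (ENNReal.ofReal (ρ 0)⁻¹ * (ENNReal.ofReal Cγ * ENNReal.ofReal Cρ) ^ n) := by
        gcongr with n
        exact hrow n x
    _ = ∑' n : ℕ, ENNReal.ofReal (ρ 0)⁻¹ *
          ENNReal.ofReal ((Cγ * Cρ * t) ^ n / n.factorial) := by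
        refine tsum_congr fun n => ?_
        rw [← ENNReal.ofReal_mul hCγ.le, ← ENNReal.ofReal_pow (by positivity), mul_left_comm,
          ← ENNReal.ofReal_mul (by positivity)]
        congr 2
        ring
    _ = ENNReal.ofReal ((ρ 0)⁻¹ * Real.exp (Cγ * Cρ * t)) := by
        rw [ENNReal.tsum_mul_left, ENNReal.tsum_ofReal_pow_div_factorial (by positivity),
          ENNReal.ofReal_mul (inv_nonneg.mpr (hρpos 0 le_rfl).le)]
end

section
/- (Quantitative spreading bound.) Under conditions (R2) and (R3), let β : S → [0,∞) have finite support Λ_β = {y : β(y) ≠ 0} ≠ ∅. Then for every t ≥ 0 and every x ∈ S, Σ_{y∈S} γ_t(x,y)·β(y) ≤ (sup_y β(y)) · ρ(0)^{-1} · exp(C_γ · C_ρ · t) · ρ(dist(x, Λ_β)), where dist(x, Λ) := inf{d(x,v) : v ∈ Λ}. -/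
open scoped ENNReal NNReal

/-- A kernel summable against a submultiplicative weight has iterates that are summable against the
same weight, with geometric growth of the sums. -/
theorem tsum_iterKernel_mul_weight_le {S : Type*} [DecidableEq S] (γ : S → S → ℝ≥0)
    (w : S → S → ℝ≥0∞) (C D K : ℝ≥0∞) (hw : ∀ x y z, w x y ≤ C * (w x z * w z y))
    (hD : ∀ x, ∑' y, (γ x y : ℝ≥0∞) * w x y ≤ D) (hK : ∀ x, w x x ≤ K) (n : ℕ) (x : S) :
    ∑' y, iterKernel γ n x y * w x y ≤ K * (D * C) ^ n := by
  induction n generalizing x with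
  | zero =>
    rw [tsum_eq_single x fun y hy => by simp [iterKernel, hy.symm]]
    simpa [iterKernel] using hK x
  | succ n ih =>
    calc ∑' y, iterKernel γ (n + 1) x y * w x y
        = ∑' y, ∑' z, (γ x z : ℝ≥0∞) * iterKernel γ n z y * w x y := by
          simp only [iterKernel, ENNReal.tsum_mul_right]
      _ ≤ ∑' y, ∑' z, C * ((γ x z * w x z) * (iterKernel γ n z y * w z y)) := by
          refine ENNReal.tsum_le_tsum fun y => ENNReal.tsum_le_tsum fun z => ?_
          calc (γ x z : ℝ≥0∞) * iterKernel γ n z y * w x y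
              ≤ γ x z * iterKernel γ n z y * (C * (w x z * w z y)) := by
                gcongr
                exact hw x y z
            _ = C * ((γ x z * w x z) * (iterKernel γ n z y * w z y)) := by ring
      _ = C * ∑' z, (γ x z * w x z) * ∑' y, iterKernel γ n z y * w z y := by
          rw [ENNReal.tsum_comm]
          simp only [ENNReal.tsum_mul_left]
      _ ≤ C * ∑' z, (γ x z * w x z) * (K * (D * C) ^ n) := by
          gcongr with z
          exact ih z
      _ ≤ C * (D * (K * (D * C) ^ n)) := by
          rw [ENNReal.tsum_mul_right]
          gcongr
          exact hD x
      _ = K * (D * C) ^ (n + 1) := by ring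

theorem tsum_ofReal_pow_div_factorial_mul_pow {t a : ℝ} (ht : 0 ≤ t) (ha : 0 ≤ a) :
    ∑' n : ℕ, ENNReal.ofReal (t ^ n / n.factorial) * ENNReal.ofReal a ^ n
      = ENNReal.ofReal (Real.exp (a * t)) := by
  have hsum := NormedSpace.expSeries_div_hasSum_exp (a * t)
  rw [← Real.exp_eq_exp_ℝ] at hsum
  rw [← hsum.tsum_eq, ENNReal.ofReal_tsum_of_nonneg (fun n => by positivity) hsum.summable]
  refine tsum_congr fun n => ?_
  rw [← ENNReal.ofReal_pow ha, ← ENNReal.ofReal_mul (by positivity)]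
  congr 1
  ring

/-- The time-`t` kernel inherits exponential growth of the sums against a submultiplicative
weight. -/
theorem tsum_timeKernel_mul_weight_le {S : Type*} [DecidableEq S] (γ : S → S → ℝ≥0)
    (w : S → S → ℝ≥0∞) {C D : ℝ} (hC : 0 ≤ C) (hD : 0 ≤ D) (K : ℝ≥0∞)
    (hw : ∀ x y z, w x y ≤ ENNReal.ofReal C * (w x z * w z y))
    (hγ : ∀ x, ∑' y, (γ x y : ℝ≥0∞) * w x y ≤ ENNReal.ofReal D) (hK : ∀ x, w x x ≤ K)
    {t : ℝ} (ht : 0 ≤ t) (x : S) :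
    ∑' y, timeKernel γ t x y * w x y ≤ K * ENNReal.ofReal (Real.exp (D * C * t)) := by
  calc ∑' y, timeKernel γ t x y * w x y
      = ∑' n : ℕ, ENNReal.ofReal (t ^ n / n.factorial) * ∑' y, iterKernel γ n x y * w x y := by
        simp only [timeKernel, ← ENNReal.tsum_mul_right, ← ENNReal.tsum_mul_left, mul_assoc]
        rw [ENNReal.tsum_comm]
    _ ≤ ∑' n : ℕ, ENNReal.ofReal (t ^ n / n.factorial) *
          (K * (ENNReal.ofReal D * ENNReal.ofReal C) ^ n) := by
        gcongr with n
        exact tsum_iterKernel_mul_weight_le γ w _ _ K hw hγ hK n x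
    _ = K * ENNReal.ofReal (Real.exp (D * C * t)) := by
        rw [← tsum_ofReal_pow_div_factorial_mul_pow ht (mul_nonneg hD hC),
          ← ENNReal.tsum_mul_left, ENNReal.ofReal_mul hD]
        exact tsum_congr fun n => mul_left_comm _ _ _

/-- Quantitative spreading bound: under (R2) and (R3), for `β : S → [0,∞)` with
nonempty finite support `Λ_β`, every `t ≥ 0` and every `x ∈ S`,
`∑_y γ_t(x,y)·β(y) ≤ (sup_y β(y))·ρ(0)⁻¹·exp(C_γ·C_ρ·t)·ρ(dist(x,Λ_β))`. -/
theorem timeKernel_spreading_bound {S : Type*} [Countable S] [DecidableEq S] [MetricSpace S]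
    (ρ : ℝ → ℝ) (hρpos : ∀ r : ℝ, 0 ≤ r → 0 < ρ r)
    (hρmono : ∀ r s : ℝ, 0 ≤ r → r ≤ s → ρ s ≤ ρ r)
    (γ : S → S → ℝ≥0) (hγdiag : ∀ x : S, γ x x = 0)
    (Cρ Cγ : ℝ) (hCρ : 0 < Cρ) (hCγ : 0 < Cγ)
    (hR2 : ∀ x y z : S, ρ (dist x z) * ρ (dist z y) ≤ Cρ * ρ (dist x y))
    (hR3 : ⨆ x : S, ∑' y : S, (γ x y : ℝ≥0∞) / ENNReal.ofReal (ρ (dist x y))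
            ≤ ENNReal.ofReal Cγ)
    (β : S → ℝ) (hβ : ∀ y : S, 0 ≤ β y)
    (hβfin : (Function.support β).Finite) (hβne : (Function.support β).Nonempty)
    (t : ℝ) (ht : 0 ≤ t) (x : S) :
    ∑' y : S, timeKernel γ t x y * ENNReal.ofReal (β y)
      ≤ ENNReal.ofReal ((⨆ y : S, β y) * (ρ 0)⁻¹ * Real.exp (Cγ * Cρ * t) *
          ρ (Metric.infDist x (Function.support β))) := by
  have hpos : ∀ x y : S, 0 < ρ (dist x y) := fun x y => hρpos _ dist_nonneg
  have hw : ∀ x y z : S, ENNReal.ofReal (ρ (dist x y))⁻¹ ≤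
      ENNReal.ofReal Cρ *
        (ENNReal.ofReal (ρ (dist x z))⁻¹ * ENNReal.ofReal (ρ (dist z y))⁻¹) := by
    intro x y z
    have hxz := hpos x z
    have hzy := hpos z y
    rw [← ENNReal.ofReal_mul (by positivity), ← ENNReal.ofReal_mul hCρ.le, ← mul_inv,
      ← div_eq_mul_inv]
    apply ENNReal.ofReal_le_ofReal
    rw [inv_eq_one_div, div_le_div_iff₀ (hpos x y) (by positivity), one_mul]
    exact hR2 x y z
  have hγ : ∀ x : S, ∑' y, (γ x y : ℝ≥0∞) * ENNReal.ofReal (ρ (dist x y))⁻¹ ≤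
      ENNReal.ofReal Cγ := by
    intro x
    refine le_trans (le_of_eq (tsum_congr fun y => ?_)) ((le_iSup _ x).trans hR3)
    rw [ENNReal.ofReal_inv_of_pos (hpos x y), div_eq_mul_inv]
  have hmain := tsum_timeKernel_mul_weight_le γ (fun x y => ENNReal.ofReal (ρ (dist x y))⁻¹)
    hCρ.le hCγ.le (ENNReal.ofReal (ρ 0)⁻¹) hw hγ (fun x => by simp) ht x
  have hbdd : BddAbove (Set.range β) := by
    refine ((hβfin.image β).insert 0).bddAbove.mono ?_
    rintro _ ⟨y, rfl⟩
    by_cases hy : β y = 0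
    · exact Or.inl hy
    · exact Or.inr ⟨y, hy, rfl⟩
  set M := ⨆ y, β y
  set R := ρ (Metric.infDist x (Function.support β))
  have hR : 0 < R := hρpos _ Metric.infDist_nonneg
  have hM : 0 ≤ M := Real.iSup_nonneg hβ
  have hβle : ∀ y, ENNReal.ofReal (β y) ≤
      ENNReal.ofReal (ρ (dist x y))⁻¹ * ENNReal.ofReal (M * R) := by
    intro y
    rw [← ENNReal.ofReal_mul (inv_nonneg.2 (hpos x y).le)]
    apply ENNReal.ofReal_le_ofReal
    have hxy := hpos x y
    by_cases hy : β y = 0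
    · rw [hy]
      positivity
    · rw [inv_mul_eq_div, le_div_iff₀ hxy]
      exact mul_le_mul (le_ciSup hbdd y)
        (hρmono _ _ Metric.infDist_nonneg (Metric.infDist_le_dist_of_mem hy)) hxy.le hM
  have hρ0 : 0 < ρ 0 := hρpos 0 le_rfl
  calc ∑' y, timeKernel γ t x y * ENNReal.ofReal (β y)
      ≤ ∑' y, timeKernel γ t x y * ENNReal.ofReal (ρ (dist x y))⁻¹ * ENNReal.ofReal (M * R) := by
        refine ENNReal.tsum_le_tsum fun y => ?_
        rw [mul_assoc]
        gcongr
        exact hβle y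
    _ ≤ ENNReal.ofReal (ρ 0)⁻¹ * ENNReal.ofReal (Real.exp (Cγ * Cρ * t)) *
          ENNReal.ofReal (M * R) := by
        rw [ENNReal.tsum_mul_right]
        gcongr
    _ = ENNReal.ofReal (M * (ρ 0)⁻¹ * Real.exp (Cγ * Cρ * t) * R) := by
        rw [← ENNReal.ofReal_mul (by positivity), ← ENNReal.ofReal_mul (by positivity)]
        congr 1
        ring
end

section
/- (Entropic cost of a time shift for finite-state Markov semigroups.) Let X be a nonempty finite set and let L be an X×X real matrix with L(x,y) ≥ 0 for all x ≠ y and Σ_y L(x,y) = 0 for every x. Set c := max_{x∈X} Σ_{y≠x} L(x,y), and for t ≥ 0 let P(t) := exp(tL) (matrix exponential). Then for every probability vector μ on X and all t, τ > 0, the relative entropy satisfies H(μP(t+τ) | μP(t)) ≤ c·τ²/t. -/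
open scoped ENNReal Classical

/-- The matrix exponential `exp(tL)`, given entrywise by the convergent series
`∑_{n≥0} (tⁿ/n!)·(Lⁿ)(x,y)`. -/
noncomputable def matrixExp {X : Type*} [Fintype X] [DecidableEq X]
    (L : Matrix X X ℝ) (t : ℝ) : Matrix X X ℝ :=
  Matrix.of fun x y => ∑' n : ℕ, (t ^ n / n.factorial) * (L ^ n) x y

/-- The relative entropy `H(p|q)` of two probability vectors on a finite set:
`∑_{x : p(x)>0} p(x)·log(p(x)/q(x))` if `p ≪ q`, and `+∞` otherwise. -/
noncomputable def relEnt {X : Type*} [Fintype X] (p q : X → ℝ) : ℝ≥0∞ :=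
  if ∀ x, q x = 0 → p x = 0 then
    ENNReal.ofReal (∑ x, if 0 < p x then p x * Real.log (p x / q x) else 0)
  else ⊤

/-- The entries of `exp(tL)` in terms of the powers of the shifted matrix `L + c`. -/
theorem hasSum_matrixExp_shift {X : Type*} [Fintype X] [DecidableEq X]
    (L : Matrix X X ℝ) (c t : ℝ) (x y : X) :
    HasSum (fun n : ℕ => (t ^ n / n.factorial) * ((L + c • (1 : Matrix X X ℝ)) ^ n) x y)
      (Real.exp (c * t) * matrixExp L t x y) := by
  let _ : NormedRing (Matrix X X ℝ) := Matrix.linftyOpNormedRing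
  let _ : NormedAlgebra ℝ (Matrix X X ℝ) := Matrix.linftyOpNormedAlgebra
  have key : ∀ A : Matrix X X ℝ,
      HasSum (fun n : ℕ => (t ^ n / n.factorial) * (A ^ n) x y) (NormedSpace.exp (t • A) x y) := by
    intro A
    have h := NormedSpace.exp_series_hasSum_exp' (𝕂 := ℝ) (t • A)
    have h2 := Pi.hasSum.1 (Pi.hasSum.1 h x) y
    have e : (fun n : ℕ => (t ^ n / n.factorial) * (A ^ n) x y)
        = fun n : ℕ => ((n.factorial : ℝ)⁻¹ • (t • A) ^ n) x y := by
      funext n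
      simp only [smul_pow, Matrix.smul_apply, smul_eq_mul]
      ring
    rw [e]
    exact h2
  have hL : matrixExp L t x y = NormedSpace.exp (t • L) x y := (key L).tsum_eq
  have hs : NormedSpace.exp (t • (L + c • (1 : Matrix X X ℝ)))
      = Real.exp (c * t) • NormedSpace.exp (t • L) := by
    have h1 : t • (L + c • (1 : Matrix X X ℝ)) = algebraMap ℝ (Matrix X X ℝ) (c * t) + t • L := by
      rw [Algebra.algebraMap_eq_smul_one, smul_add, smul_smul, mul_comm t c, add_comm]
    have h2 : NormedSpace.exp (algebraMap ℝ (Matrix X X ℝ) (c * t))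
        = algebraMap ℝ (Matrix X X ℝ) (NormedSpace.exp (c * t)) :=
      (NormedSpace.algebraMap_exp_comm (c * t)).symm
    rw [h1, Matrix.exp_add_of_commute _ _ (Algebra.commute_algebraMap_left _ _),
      h2, ← Algebra.smul_def, Real.exp_eq_exp_ℝ]
  have h := key (L + c • (1 : Matrix X X ℝ))
  rwa [hs, Matrix.smul_apply, smul_eq_mul, ← hL] at h

theorem hasSum_nat_mul_pow_div_factorial (x : ℝ) :
    HasSum (fun n : ℕ => (n : ℝ) * (x ^ n / n.factorial)) (x * Real.exp x) := by
  rw [← hasSum_nat_add_iff' 1]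
  have h := (NormedSpace.expSeries_div_hasSum_exp (𝔸 := ℝ) x).mul_left x
  rw [← Real.exp_eq_exp_ℝ] at h
  have e : (fun n : ℕ => ((n + 1 : ℕ) : ℝ) * (x ^ (n + 1) / ((n + 1).factorial : ℝ)))
      = fun n : ℕ => x * (x ^ n / n.factorial) := by
    funext n
    have : (n.factorial : ℝ) ≠ 0 := by positivity
    have : (n : ℝ) + 1 ≠ 0 := by positivity
    rw [Nat.factorial_succ]
    push_cast
    field_simp
    ring
  rw [e]
  simpa using h

/-- The log-sum inequality for an exponential generating function with nonnegative
coefficients evaluated at two points. -/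
theorem mul_log_div_le_of_hasSum {b : ℕ → ℝ} (hb : ∀ n, 0 ≤ b n) {s s' F F' G : ℝ}
    (hs : 0 < s) (hs' : 0 < s') (hF0 : 0 < F) (hFpos' : 0 < F')
    (hF : HasSum (fun n : ℕ => s ^ n / n.factorial * b n) F)
    (hF' : HasSum (fun n : ℕ => s' ^ n / n.factorial * b n) F')
    (hG : HasSum (fun n : ℕ => n * (s' ^ n / n.factorial * b n)) G) :
    F' * Real.log (F' / F) ≤ Real.log (s' / s) * G := by
  have h := hasSum_le (fun n => ?_) (hF'.sub (hF.mul_left (F' / F)))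
    ((hG.mul_left (Real.log (s' / s))).sub (hF'.mul_left (Real.log (F' / F))))
  · rw [div_mul_cancel₀ _ hF0.ne'] at h
    linarith
  · have hr : 0 < F' / F := by positivity
    have hx : 0 < (s' / s) ^ n / (F' / F) := by positivity
    have hlog := Real.one_sub_inv_le_log_of_pos hx
    rw [Real.log_div (by positivity) hr.ne', Real.log_pow] at hlog
    have hw : 0 ≤ s' ^ n / n.factorial * b n := mul_nonneg (by positivity) (hb n)
    have h1 := mul_le_mul_of_nonneg_left hlog hw
    have h2 : s' ^ n / n.factorial * b n * (1 - ((s' / s) ^ n / (F' / F))⁻¹)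
        = s' ^ n / n.factorial * b n - F' / F * (s ^ n / n.factorial * b n) := by
      rw [inv_div, div_pow]
      field_simp
    linarith

theorem Matrix.pow_nonneg_of_nonneg {X : Type*} [Fintype X] [DecidableEq X]
    {B : Matrix X X ℝ} (hB : ∀ x y, 0 ≤ B x y) (n : ℕ) (x y : X) : 0 ≤ (B ^ n) x y := by
  induction n generalizing y with
  | zero => rw [pow_zero, Matrix.one_apply]; split_ifs <;> norm_num
  | succ n ih =>
    rw [pow_succ, Matrix.mul_apply]
    exact Finset.sum_nonneg fun z _ => mul_nonneg (ih z) (hB z y)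

theorem Matrix.sum_row_pow {X : Type*} [Fintype X] [DecidableEq X]
    {B : Matrix X X ℝ} {c : ℝ} (hB : ∀ x, ∑ y, B x y = c) (n : ℕ) (x : X) :
    ∑ y, (B ^ n) x y = c ^ n := by
  induction n with
  | zero => simp [Matrix.one_apply]
  | succ n ih =>
    simp_rw [pow_succ, Matrix.mul_apply]
    rw [Finset.sum_comm]
    simp_rw [← Finset.mul_sum, hB, ← Finset.sum_mul, ih]

/-- Entropic cost of a time shift for finite-state Markov semigroups:
if `L` is a Markov generator on a nonempty finite set `X`, with
`c = max_x ∑_{y≠x} L(x,y)`, then for every probability vector `μ` and all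
`t, τ > 0`, `H(μP(t+τ) | μP(t)) ≤ c·τ²/t` where `P(t) = exp(tL)`. -/
theorem entropic_cost_time_shift {X : Type*} [Fintype X] [Nonempty X] [DecidableEq X]
    (L : Matrix X X ℝ)
    (hoff : ∀ x y : X, x ≠ y → 0 ≤ L x y)
    (hrow : ∀ x : X, ∑ y, L x y = 0)
    (c : ℝ)
    (hc : IsGreatest (Set.range fun x : X => ∑ y ∈ Finset.univ.erase x, L x y) c)
    (μ : X → ℝ) (hμ0 : ∀ x : X, 0 ≤ μ x) (hμ1 : ∑ x, μ x = 1)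
    (t τ : ℝ) (ht : 0 < t) (hτ : 0 < τ) :
    relEnt (fun y => ∑ x, μ x * matrixExp L (t + τ) x y)
        (fun y => ∑ x, μ x * matrixExp L t x y) ≤
      ENNReal.ofReal (c * τ ^ 2 / t) := by
  have hc0 : 0 ≤ c := by
    obtain ⟨x, hx⟩ := hc.1
    rw [← hx]
    exact Finset.sum_nonneg fun y hy => hoff x y (Finset.ne_of_mem_erase hy).symm
  set B : Matrix X X ℝ := L + c • (1 : Matrix X X ℝ) with hBdef
  have hB : ∀ x y, 0 ≤ B x y := by
    intro x y
    by_cases hxy : x = y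
    · subst hxy
      have h1 : ∑ y ∈ Finset.univ.erase x, L x y ≤ c := hc.2 ⟨x, rfl⟩
      have h2 := Finset.sum_erase_add Finset.univ (L x) (Finset.mem_univ x)
      rw [hrow] at h2
      simp only [hBdef, Matrix.add_apply, Matrix.smul_apply, Matrix.one_apply_eq, smul_eq_mul]
      linarith
    · simpa [hBdef, Matrix.one_apply_ne hxy] using hoff x y hxy
  have hBrow : ∀ x, ∑ y, B x y = c := fun x => by
    simp [hBdef, Finset.sum_add_distrib, hrow, Matrix.one_apply]
  set b : X → ℕ → ℝ := fun y n => ∑ x, μ x * (B ^ n) x y with hbdef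
  have hb0 : ∀ y n, 0 ≤ b y n := fun y n =>
    Finset.sum_nonneg fun x _ => mul_nonneg (hμ0 x) (Matrix.pow_nonneg_of_nonneg hB n x y)
  have hbsum : ∀ n, ∑ y, b y n = c ^ n := fun n => by
    simp only [hbdef]
    rw [Finset.sum_comm]
    simp_rw [← Finset.mul_sum, Matrix.sum_row_pow hBrow, ← Finset.sum_mul, hμ1, one_mul]
  set P : ℝ → X → ℝ := fun s y => ∑ x, μ x * matrixExp L s x y with hPdef
  have hF : ∀ s y, HasSum (fun n : ℕ => s ^ n / n.factorial * b y n)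
      (Real.exp (c * s) * P s y) := by
    intro s y
    have h := hasSum_sum (s := Finset.univ)
      fun x _ => (hasSum_matrixExp_shift L c s x y).mul_left (μ x)
    have e1 : (fun n : ℕ => s ^ n / n.factorial * b y n)
        = fun n : ℕ => ∑ x, μ x * (s ^ n / n.factorial * (B ^ n) x y) := by
      funext n
      rw [hbdef, Finset.mul_sum]
      exact Finset.sum_congr rfl fun x _ => by ring
    have e2 : Real.exp (c * s) * P s y
        = ∑ x, μ x * (Real.exp (c * s) * matrixExp L s x y) := by
      rw [hPdef, Finset.mul_sum]
      exact Finset.sum_congr rfl fun x _ => by ring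
    rw [e1, e2]
    exact h
  set s' := t + τ with hsdef
  have hs' : 0 < s' := by positivity
  have hM : HasSum (fun n : ℕ => ∑ y, (n : ℝ) * (s' ^ n / n.factorial * b y n))
      (c * s' * Real.exp (c * s')) := by
    convert hasSum_nat_mul_pow_div_factorial (c * s') using 1
    funext n
    rw [← Finset.mul_sum, ← Finset.mul_sum, hbsum, mul_pow]
    ring
  have hterm : ∀ (y : X) (n : ℕ), 0 ≤ (n : ℝ) * (s' ^ n / (n.factorial : ℝ) * b y n) := fun y n =>
    mul_nonneg (by positivity) (mul_nonneg (by positivity) (hb0 y n))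
  have hGs : ∀ y, Summable (fun n : ℕ => (n : ℝ) * (s' ^ n / n.factorial * b y n)) := fun y =>
    hM.summable.of_nonneg_of_le (hterm y) fun n =>
      Finset.single_le_sum (f := fun y => (n : ℝ) * (s' ^ n / n.factorial * b y n))
        (fun z _ => hterm z n) (Finset.mem_univ y)
  set G : X → ℝ := fun y => ∑' n : ℕ, (n : ℝ) * (s' ^ n / n.factorial * b y n) with hGdef
  have hGsum : ∑ y, G y = c * s' * Real.exp (c * s') :=
    (hasSum_sum fun y _ => (hGs y).hasSum).unique hM
  have hG0 : ∀ y, 0 ≤ G y := fun y => tsum_nonneg (hterm y)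
  have hFnn : ∀ s, 0 < s → ∀ y, 0 ≤ Real.exp (c * s) * P s y := fun s hs y =>
    (hF s y).nonneg fun n => mul_nonneg (by positivity) (hb0 y n)
  have hac : ∀ y, P t y = 0 → P s' y = 0 := by
    intro y hy
    have h := hF t y
    rw [hy, mul_zero, hasSum_zero_iff_of_nonneg
      fun n => mul_nonneg (by positivity) (hb0 y n)] at h
    have hbz : ∀ n, b y n = 0 := fun n => by
      have h1 := congrFun h n
      have h2 : t ^ n / (n.factorial : ℝ) ≠ 0 := by positivity
      simpa [h2, ht.ne', Nat.factorial_ne_zero] using h1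
    have h3 := hF s' y
    simp only [hbz, mul_zero] at h3
    have h4 := h3.unique hasSum_zero
    exact (mul_eq_zero.1 h4).resolve_left (Real.exp_pos _).ne'
  have hP1 : ∑ y, P s' y = 1 := by
    have h := hasSum_sum (s := Finset.univ) fun y _ => hF s' y
    have h2 := NormedSpace.expSeries_div_hasSum_exp (𝔸 := ℝ) (c * s')
    rw [← Real.exp_eq_exp_ℝ] at h2
    have h3 : (fun n : ℕ => ∑ y, s' ^ n / (n.factorial : ℝ) * b y n)
        = fun n : ℕ => (c * s') ^ n / (n.factorial : ℝ) := by
      funext n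
      rw [← Finset.mul_sum, hbsum, mul_pow]
      ring
    rw [h3, ← Finset.mul_sum] at h
    have h4 := h.unique h2
    exact mul_left_cancel₀ (Real.exp_pos (c * s')).ne' (h4.trans (mul_one _).symm)
  have hlog0 : 0 ≤ Real.log (s' / t) :=
    Real.log_nonneg (by rw [le_div_iff₀ ht]; linarith)
  have hy : ∀ y, (if 0 < P s' y then P s' y * Real.log (P s' y / P t y) else 0)
      ≤ Real.exp (-(c * s')) * (Real.log (s' / t) * G y) - c * τ * P s' y := by
    intro y
    have hPnn : 0 ≤ P s' y := nonneg_of_mul_nonneg_right (hFnn s' hs' y) (Real.exp_pos _)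
    split_ifs with hpos
    · have hq : 0 < P t y := by
        refine lt_of_le_of_ne (nonneg_of_mul_nonneg_right (hFnn t ht y) (Real.exp_pos _)) ?_
        exact fun h => hpos.ne' (hac y h.symm)
      have h := mul_log_div_le_of_hasSum (hb0 y) ht hs' (by positivity) (by positivity)
        (hF t y) (hF s' y) (hGs y).hasSum
      have hlog : Real.log (Real.exp (c * s') * P s' y / (Real.exp (c * t) * P t y))
          = c * τ + Real.log (P s' y / P t y) := by
        rw [mul_div_mul_comm, Real.log_mul (by positivity) (by positivity), ← Real.exp_sub,
          Real.log_exp, hsdef]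
        ring
      rw [hlog] at h
      have h2 := mul_le_mul_of_nonneg_left h (Real.exp_pos (-(c * s'))).le
      have h3 : Real.exp (-(c * s')) * Real.exp (c * s') = 1 := by
        rw [← Real.exp_add, neg_add_cancel, Real.exp_zero]
      rw [← mul_assoc, ← mul_assoc, h3, one_mul] at h2
      linarith
    · have hz : P s' y = 0 := le_antisymm (not_lt.1 hpos) hPnn
      rw [hz, mul_zero, sub_zero]
      exact mul_nonneg (Real.exp_pos _).le (mul_nonneg hlog0 (hG0 y))
  rw [relEnt, if_pos hac]
  refine ENNReal.ofReal_le_ofReal ((Finset.sum_le_sum fun y _ => hy y).trans ?_)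
  rw [Finset.sum_sub_distrib, ← Finset.mul_sum, ← Finset.mul_sum, ← Finset.mul_sum, hGsum, hP1]
  have h3 : Real.exp (-(c * s')) * (Real.log (s' / t) * (c * s' * Real.exp (c * s')))
      = c * s' * Real.log (s' / t) := by
    rw [Real.exp_neg]
    field_simp
  rw [h3]
  have h4 := mul_le_mul_of_nonneg_left
    (Real.log_le_sub_one_of_pos (div_pos hs' ht)) (mul_nonneg hc0 hs'.le)
  have h5 : c * s' * (s' / t - 1) - c * τ * 1 = c * τ ^ 2 / t := by
    rw [hsdef]
    field_simp
    ring
  linarith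
end
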